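/- Suppose 0 < E < T ≤ N, the messages are mutually independent with H(W_k) = L for every k, E-security holds, T-privacy holds, and ε-correctness holds for every message k ∈ [1:K]. Then the common randomness satisfies H(S) ≥ (E/(N−E)) · (L − ε) · Σ_{i=0}^{K−1} ((T−E)/(N−E))^i. -/

import Mathlib

open Finset

/-- Probability that the finitely-valued random variable `X` (on the finite
probability space with pmf `p`) takes the value `x`. -/
noncomputable def prC {Ω α : Type*} [Fintype Ω] [DecidableEq α]
    (p : Ω → ℝ) (X : Ω → α) (x : α) : ℝ :=
  ∑ ω, if X ω = x then p ω else 0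

/-- Shannon entropy `H(X)` of a finitely-valued random variable. -/
noncomputable def entH {Ω α : Type*} [Fintype Ω] [Fintype α] [DecidableEq α]
    (p : Ω → ℝ) (X : Ω → α) : ℝ :=
  -∑ x, prC p X x * Real.log (prC p X x)

/-- Conditional entropy `H(X|Y) = H(X,Y) - H(Y)`. -/
noncomputable def condEntH {Ω α β : Type*} [Fintype Ω] [Fintype α] [DecidableEq α]
    [Fintype β] [DecidableEq β] (p : Ω → ℝ) (X : Ω → α) (Y : Ω → β) : ℝ :=
  entH p (fun ω => (X ω, Y ω)) - entH p Y

/-- Mutual information `I(X;Y) = H(X) + H(Y) - H(X,Y)`. -/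
noncomputable def mutInfH {Ω α β : Type*} [Fintype Ω] [Fintype α] [DecidableEq α]
    [Fintype β] [DecidableEq β] (p : Ω → ℝ) (X : Ω → α) (Y : Ω → β) : ℝ :=
  entH p X + entH p Y - entH p (fun ω => (X ω, Y ω))

/-- A submodular set function gains, on some set `B ⊇ D` of prescribed size, at least the
proportional share of its total gain over `D`. -/
theorem exists_superset_card_eq_proportional_gain {α : Type*} [Fintype α] [DecidableEq α]
    (f : Finset α → ℝ)
    (hf : ∀ X Y Z : Finset α, Z ⊆ X → Z ⊆ Y → f (X ∪ Y) + f Z ≤ f X + f Y)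
    (D : Finset α) {t : ℕ} (hDt : D.card ≤ t) (ht : t ≤ Fintype.card α) :
    ∃ B, D ⊆ B ∧ B.card = t ∧
      ((t : ℝ) - D.card) * (f univ - f D) ≤ ((Fintype.card α : ℝ) - D.card) * (f B - f D) := by
  have hsum : ∀ B C : Finset α, f (C ∪ B) - f B ≤ ∑ x ∈ C, (f (insert x B) - f B) := by
    intro B C
    induction C using Finset.induction_on with
    | empty => simp
    | insert x C hx ih =>
      rw [Finset.sum_insert hx]
      have h1 := hf (insert x B) (C ∪ B) B (Finset.subset_insert _ _) Finset.subset_union_right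
      have h2 : insert x B ∪ (C ∪ B) = insert x C ∪ B := by
        ext y; simp only [mem_union, mem_insert]; tauto
      rw [h2] at h1
      linarith
  induction t, hDt using Nat.le_induction with
  | base => exact ⟨D, Subset.rfl, rfl, by simp⟩
  | succ t hDt ih =>
    obtain ⟨B, hDB, hB, hgain⟩ := ih (by omega)
    have hcard : (Bᶜ.card : ℝ) = Fintype.card α - t := by
      rw [Finset.card_compl, hB, Nat.cast_sub (by omega)]
    have hne : Bᶜ.Nonempty := by
      rw [← Finset.card_pos, Finset.card_compl]; omega
    obtain ⟨x, hx, hmax⟩ := Finset.exists_max_image Bᶜ (fun x => f (insert x B) - f B) hne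
    have hle := Finset.sum_le_card_nsmul Bᶜ _ _ hmax
    have htot := hsum B Bᶜ
    rw [nsmul_eq_mul, hcard] at hle
    rw [Finset.union_comm, Finset.union_compl] at htot
    have hxB : x ∉ B := by simpa using hx
    refine ⟨insert x B, hDB.trans (Finset.subset_insert _ _), by
      rw [Finset.card_insert_of_notMem hxB, hB], ?_⟩
    have hu : (t : ℝ) + 1 ≤ Fintype.card α := by exact_mod_cast ht
    have hd : (D.card : ℝ) ≤ t := by exact_mod_cast hDt
    push_cast
    have key : f univ - f B ≤ ((Fintype.card α : ℝ) - t) * (f (insert x B) - f B) := by linarith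
    have h3 := mul_le_mul_of_nonneg_left key (by linarith : (0 : ℝ) ≤ Fintype.card α - D.card)
    have h4 := mul_le_mul_of_nonneg_left hgain (by linarith : (0 : ℝ) ≤ Fintype.card α - t - 1)
    refine le_of_mul_le_mul_left ?_ (by linarith : (0 : ℝ) < Fintype.card α - t)
    linarith

/-- The randomness bound for an abstract family `g k B C`, which stands for the entropy of the
answers of the servers `B` to the queries for message `k` together with the messages in `C`,
given the queries. -/
theorem randomness_bound_of_submodular {K N E T : ℕ} (hE : 0 < E) (hET : E < T) (hTN : T ≤ N)
    (hK : 0 < K) (L ε σ : ℝ) (g : Fin K → Finset (Fin N) → Finset (Fin K) → ℝ)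
    (hsub : ∀ k C, ∀ X Y Z : Finset (Fin N), Z ⊆ X → Z ⊆ Y →
      g k (X ∪ Y) C + g k Z C ≤ g k X C + g k Y C)
    (hmono : ∀ k C, ∀ X Y : Finset (Fin N), X ⊆ Y → g k X C ≤ g k Y C)
    (hempty : ∀ k, g k ∅ ∅ = 0)
    (hpriv : ∀ k k' B C, B.card ≤ T → g k B C = g k' B C)
    (hsec : ∀ k B C, B.card = E → g k B C = g k B ∅ + C.card * L)
    (hcor : ∀ k C, g k univ (insert k C) ≤ g k univ C + ε)
    (hσ : ∀ k B, B.card = E → g k B ∅ ≤ σ) :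
    ((E : ℝ) / ((N : ℝ) - E)) * (L - ε) *
      ∑ i ∈ Finset.range K, (((T : ℝ) - E) / ((N : ℝ) - E)) ^ i ≤ σ := by
  have hEr : (0 : ℝ) < E := by exact_mod_cast hE
  have hETr : (E : ℝ) < T := by exact_mod_cast hET
  have hTNr : (T : ℝ) ≤ N := by exact_mod_cast hTN
  have hNE : (0 : ℝ) < N - E := by linarith
  set r : ℝ := ((T : ℝ) - E) / ((N : ℝ) - E) with hr
  have gain : ∀ (B : Finset (Fin N)), B.card = E → ∀ m j : ℕ, ∀ hj : j < K, j + m + 1 = K →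
      (L - ε) * ∑ i ∈ Finset.range (m + 1), r ^ i ≤
        g ⟨j, hj⟩ univ (Finset.univ.filter fun i => i.1 < j)
          - g ⟨j, hj⟩ B (Finset.univ.filter fun i => i.1 < j) := by
    intro B hB m
    have step : ∀ j (hj : j < K),
        (L - ε) + (g ⟨j, hj⟩ univ (Finset.univ.filter fun i => i.1 < j + 1)
          - g ⟨j, hj⟩ B (Finset.univ.filter fun i => i.1 < j + 1)) ≤
        g ⟨j, hj⟩ univ (Finset.univ.filter fun i => i.1 < j)
          - g ⟨j, hj⟩ B (Finset.univ.filter fun i => i.1 < j) := by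
      intro j hj
      have hins : (Finset.univ.filter fun i : Fin K => i.1 < j + 1) =
          insert ⟨j, hj⟩ (Finset.univ.filter fun i => i.1 < j) := by
        ext i
        simp only [mem_filter, mem_univ, true_and, mem_insert, Fin.ext_iff]
        omega
      have hc := hcor ⟨j, hj⟩ (Finset.univ.filter fun i => i.1 < j)
      have h1 := hsec ⟨j, hj⟩ B (insert ⟨j, hj⟩ (Finset.univ.filter fun i => i.1 < j)) hB
      have h2 := hsec ⟨j, hj⟩ B (Finset.univ.filter fun i => i.1 < j) hB
      rw [Finset.card_insert_of_notMem (by simp)] at h1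
      push_cast at h1
      rw [hins]
      linarith
    induction m with
    | zero =>
      intro j hj _
      have h1 := step j hj
      have h2 := hmono ⟨j, hj⟩ (Finset.univ.filter fun i => i.1 < j + 1) B univ (subset_univ _)
      simp only [zero_add, Finset.range_one, Finset.sum_singleton, pow_zero, mul_one]
      linarith
    | succ m ih =>
      intro j hj hjm
      have hj' : j + 1 < K := by omega
      have h1 := step j hj
      have h2 := ih (j + 1) hj' (by omega)
      set C : Finset (Fin K) := Finset.univ.filter fun i => i.1 < j + 1
      obtain ⟨B', hBB', hB', hgain⟩ := exists_superset_card_eq_proportional_gain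
        (fun X => g ⟨j + 1, hj'⟩ X C) (hsub _ _) B (t := T) (by omega) (by simpa using hTN)
      simp only [Fintype.card_fin, hB] at hgain
      rw [hpriv ⟨j + 1, hj'⟩ ⟨j, hj⟩ B' C (by omega),
        hpriv ⟨j + 1, hj'⟩ ⟨j, hj⟩ B C (by omega)] at hgain
      rw [hpriv ⟨j + 1, hj'⟩ ⟨j, hj⟩ B C (by omega)] at h2
      have h3 := hmono ⟨j, hj⟩ C B' univ (subset_univ _)
      have h4 : r * (g ⟨j + 1, hj'⟩ univ C - g ⟨j, hj⟩ B C) ≤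
          g ⟨j, hj⟩ B' C - g ⟨j, hj⟩ B C := by
        rw [hr, div_mul_eq_mul_div, div_le_iff₀ hNE]
        linarith
      have h5 := mul_le_mul_of_nonneg_left h2 (div_nonneg (by linarith) hNE.le : 0 ≤ r)
      have h6 : ∑ i ∈ Finset.range (m + 1 + 1), r ^ i =
          1 + r * ∑ i ∈ Finset.range (m + 1), r ^ i := by
        rw [Finset.sum_range_succ', Finset.mul_sum, pow_zero, add_comm]
        simp only [pow_succ']
      rw [h6]
      linarith
  obtain ⟨B, -, hB, hgain⟩ := exists_superset_card_eq_proportional_gain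
    (fun X => g ⟨0, hK⟩ X ∅) (hsub _ _) ∅ (t := E) (by simp) (by simp; omega)
  have h1 := gain B hB (K - 1) 0 hK (by omega)
  simp only [Nat.sub_add_cancel hK, not_lt_zero, Finset.filter_false] at h1
  simp only [Fintype.card_fin, Finset.card_empty, hempty, Nat.cast_zero, sub_zero] at hgain
  have h2 := hσ ⟨0, hK⟩ B hB
  rw [mul_assoc, div_mul_eq_mul_div, div_le_iff₀ hNE]
  have h3 := mul_le_mul_of_nonneg_left h1 hEr.le
  have h4 := mul_le_mul_of_nonneg_left h2 hNE.le
  linarith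

section KerOn

variable {Ω : Type*}

theorem ker_prodMk {α β : Type*} (X : Ω → α) (Y : Ω → β) :
    Setoid.ker (fun ω => (X ω, Y ω)) = Setoid.ker X ⊓ Setoid.ker Y :=
  Setoid.ext fun _ _ => Prod.ext_iff

/-- The partition generated by the members of a family indexed by `B`. -/
def kerOn {ι α : Type*} (X : ι → Ω → α) (B : Finset ι) : Setoid Ω :=
  Setoid.ker fun ω (i : {x // x ∈ B}) => X i.1 ω

theorem kerOn_iff {ι α : Type*} {X : ι → Ω → α} {B : Finset ι} {ω ω' : Ω} :
    kerOn X B ω ω' ↔ ∀ i ∈ B, X i ω = X i ω' := by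
  rw [kerOn, Setoid.ker_def, funext_iff, Subtype.forall]

theorem kerOn_anti {ι α : Type*} (X : ι → Ω → α) {B C : Finset ι} (h : B ⊆ C) :
    kerOn X C ≤ kerOn X B := fun _ _ hC =>
  kerOn_iff.2 fun i hi => kerOn_iff.1 hC i (h hi)

theorem kerOn_empty {ι α : Type*} (X : ι → Ω → α) : kerOn X ∅ = ⊤ :=
  top_le_iff.1 fun _ _ _ => kerOn_iff.2 (by simp)

theorem kerOn_union {ι α : Type*} [DecidableEq ι] (X : ι → Ω → α) (B C : Finset ι) :
    kerOn X (B ∪ C) = kerOn X B ⊓ kerOn X C :=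
  Setoid.ext fun ω ω' => by
    change _ ↔ kerOn X B ω ω' ∧ kerOn X C ω ω'
    simp only [kerOn_iff, mem_union, or_imp, forall_and]

theorem kerOn_singleton {ι α : Type*} (X : ι → Ω → α) (i : ι) :
    kerOn X {i} = Setoid.ker (X i) :=
  Setoid.ext fun ω ω' => by simp [kerOn_iff, Setoid.ker_def]

theorem kerOn_insert {ι α : Type*} [DecidableEq ι] (X : ι → Ω → α) (i : ι) (B : Finset ι) :
    kerOn X (insert i B) = Setoid.ker (X i) ⊓ kerOn X B := by
  rw [Finset.insert_eq, kerOn_union, kerOn_singleton]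

theorem kerOn_univ {ι α : Type*} [Fintype ι] (X : ι → Ω → α) :
    kerOn X univ = Setoid.ker fun ω i => X i ω :=
  Setoid.ext fun ω ω' => by simp [kerOn_iff, Setoid.ker_def, funext_iff]

end KerOn

section SetoidEntropy

variable {Ω : Type*} [Fintype Ω]

open scoped Classical in
/-- The probability of the class of `ω` in the partition `r`. -/
noncomputable def classProb (p : Ω → ℝ) (r : Setoid Ω) (ω : Ω) : ℝ :=
  ∑ ω', if r ω ω' then p ω' else 0

/-- The entropy of the partition of the sample space into the classes of `r`. -/
noncomputable def setoidEnt (p : Ω → ℝ) (r : Setoid Ω) : ℝ :=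
  -∑ ω, p ω * Real.log (classProb p r ω)

theorem prC_eq_classProb {α : Type*} [DecidableEq α] (p : Ω → ℝ) (X : Ω → α) (ω : Ω) :
    prC p X (X ω) = classProb p (Setoid.ker X) ω := by
  unfold prC classProb
  refine Finset.sum_congr rfl fun ω' _ => ?_
  simp only [Setoid.ker_def, eq_comm]

theorem sum_prC_mul {α : Type*} [Fintype α] [DecidableEq α] (p : Ω → ℝ) (X : Ω → α)
    (f : α → ℝ) : ∑ x, prC p X x * f x = ∑ ω, p ω * f (X ω) := by
  simp only [prC, Finset.sum_mul]
  rw [Finset.sum_comm]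
  simp

theorem entH_eq_setoidEnt {α : Type*} [Fintype α] [DecidableEq α] (p : Ω → ℝ) (X : Ω → α) :
    entH p X = setoidEnt p (Setoid.ker X) := by
  unfold entH setoidEnt
  rw [sum_prC_mul p X fun x => Real.log (prC p X x)]
  simp only [prC_eq_classProb]

variable {p : Ω → ℝ}

theorem classProb_congr {r : Setoid Ω} {ω ω' : Ω} (h : r ω ω') :
    classProb p r ω = classProb p r ω' := by
  unfold classProb
  refine Finset.sum_congr rfl fun ω'' _ => ?_
  have : r ω ω'' ↔ r ω' ω'' := ⟨fun h' => r.trans' (r.symm' h) h', fun h' => r.trans' h h'⟩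
  by_cases h' : r ω' ω''
  · rw [if_pos h', if_pos (this.2 h')]
  · rw [if_neg h', if_neg (mt this.1 h')]

theorem classProb_nonneg (hp0 : ∀ ω, 0 ≤ p ω) (r : Setoid Ω) (ω : Ω) :
    0 ≤ classProb p r ω :=
  Finset.sum_nonneg fun ω' _ => by split_ifs <;> simp [hp0]

theorem le_classProb (hp0 : ∀ ω, 0 ≤ p ω) (r : Setoid Ω) (ω : Ω) :
    p ω ≤ classProb p r ω := by
  classical
  have := Finset.single_le_sum (f := fun ω' => if r ω ω' then p ω' else 0)
    (fun ω' _ => by split_ifs <;> simp [hp0]) (Finset.mem_univ ω)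
  simpa [classProb, r.refl' ω] using this

theorem classProb_mono (hp0 : ∀ ω, 0 ≤ p ω) {r s : Setoid Ω} (h : r ≤ s) (ω : Ω) :
    classProb p r ω ≤ classProb p s ω := by
  refine Finset.sum_le_sum fun ω' _ => ?_
  by_cases hr : r ω ω'
  · simp [hr, h hr]
  · simp only [hr, if_false]
    split_ifs <;> simp [hp0]

theorem setoidEnt_anti (hp0 : ∀ ω, 0 ≤ p ω) {r s : Setoid Ω} (h : r ≤ s) :
    setoidEnt p s ≤ setoidEnt p r := by
  refine neg_le_neg (Finset.sum_le_sum fun ω _ => ?_)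
  rcases (hp0 ω).eq_or_lt with h0 | h0
  · simp [← h0]
  · exact mul_le_mul_of_nonneg_left
      (Real.log_le_log (h0.trans_le (le_classProb hp0 r ω)) (classProb_mono hp0 h ω)) h0.le

theorem setoidEnt_top (hp1 : ∑ ω, p ω = 1) : setoidEnt p (⊤ : Setoid Ω) = 0 := by
  simp [setoidEnt, classProb, hp1]

open scoped Classical in
theorem sum_class_div_classProb_le_one (r : Setoid Ω) (ω : Ω) :
    ∑ ω', (if r ω ω' then p ω' / classProb p r ω' else 0) ≤ 1 := by
  have : ∀ ω', (if r ω ω' then p ω' / classProb p r ω' else 0)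
      = (if r ω ω' then p ω' else 0) / classProb p r ω := by
    intro ω'
    by_cases h : r ω ω'
    · simp [h, classProb_congr h]
    · simp [h]
  simp only [this, ← Finset.sum_div]
  exact div_self_le_one _

theorem sum_classProb_ratio_le_one (hp0 : ∀ ω, 0 ≤ p ω) (hp1 : ∑ ω, p ω = 1)
    {X Y Z : Setoid Ω} (hX : X ≤ Z) (hY : Y ≤ Z) :
    ∑ ω, p ω * (classProb p X ω * classProb p Y ω /
      (classProb p (X ⊓ Y) ω * classProb p Z ω)) ≤ 1 := by
  classical
  have inner : ∀ a b, ∑ ω, (if X ω a ∧ Y ω b then p ω /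
      (classProb p (X ⊓ Y) ω * classProb p Z ω) else 0) ≤
      if Z a b then 1 / classProb p Z b else 0 := by
    intro a b
    by_cases h : ∃ ω, X ω a ∧ Y ω b
    · obtain ⟨ω₀, ha, hb⟩ := h
      have hab : Z a b := Z.trans' (Z.symm' (hX ha)) (hY hb)
      rw [if_pos hab]
      have hterm : ∀ ω, (if X ω a ∧ Y ω b then p ω /
          (classProb p (X ⊓ Y) ω * classProb p Z ω) else 0) =
          (if (X ⊓ Y) ω₀ ω then p ω / classProb p (X ⊓ Y) ω else 0) / classProb p Z b := by
        intro ω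
        have hiff : (X ω a ∧ Y ω b) ↔ (X ⊓ Y) ω₀ ω :=
          ⟨fun h => ⟨X.trans' ha (X.symm' h.1), Y.trans' hb (Y.symm' h.2)⟩,
            fun h => ⟨X.trans' (X.symm' h.1) ha, Y.trans' (Y.symm' h.2) hb⟩⟩
        by_cases h : (X ⊓ Y) ω₀ ω
        · rw [if_pos (hiff.2 h), if_pos h, classProb_congr (hY (hiff.2 h).2), div_div]
        · rw [if_neg (mt hiff.1 h), if_neg h, zero_div]
      simp only [hterm, ← Finset.sum_div]
      exact div_le_div_of_nonneg_right (sum_class_div_classProb_le_one _ _)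
        (classProb_nonneg hp0 _ _)
    · push Not at h
      have : ∀ ω, ¬ (X ω a ∧ Y ω b) := fun ω hω => h ω hω.1 hω.2
      simp only [this, if_false, Finset.sum_const_zero]
      split_ifs
      · exact one_div_nonneg.2 (classProb_nonneg hp0 _ _)
      · exact le_rfl
  calc ∑ ω, p ω * (classProb p X ω * classProb p Y ω /
        (classProb p (X ⊓ Y) ω * classProb p Z ω))
      = ∑ ω, ∑ a, ∑ b, p a * p b * (if X ω a ∧ Y ω b then p ω /
        (classProb p (X ⊓ Y) ω * classProb p Z ω) else 0) := by
        refine Finset.sum_congr rfl fun ω _ => ?_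
        have : classProb p X ω * classProb p Y ω =
            ∑ a, ∑ b, if X ω a ∧ Y ω b then p a * p b else 0 := by
          unfold classProb
          rw [Finset.sum_mul_sum]
          refine Finset.sum_congr rfl fun a _ => Finset.sum_congr rfl fun b _ => ?_
          by_cases h1 : X ω a <;> by_cases h2 : Y ω b <;> simp [h1, h2]
        rw [this, Finset.sum_div, Finset.mul_sum]
        refine Finset.sum_congr rfl fun a _ => ?_
        rw [Finset.sum_div, Finset.mul_sum]
        refine Finset.sum_congr rfl fun b _ => ?_
        split_ifs <;> ring
    _ = ∑ a, ∑ b, p a * p b * ∑ ω, (if X ω a ∧ Y ω b then p ω /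
        (classProb p (X ⊓ Y) ω * classProb p Z ω) else 0) := by
        rw [Finset.sum_comm]
        refine Finset.sum_congr rfl fun a _ => ?_
        rw [Finset.sum_comm]
        simp only [Finset.mul_sum]
    _ ≤ ∑ a, ∑ b, p a * p b * (if Z a b then 1 / classProb p Z b else 0) :=
        Finset.sum_le_sum fun a _ => Finset.sum_le_sum fun b _ =>
          mul_le_mul_of_nonneg_left (inner a b) (mul_nonneg (hp0 a) (hp0 b))
    _ = ∑ a, p a * ∑ b, (if Z a b then p b / classProb p Z b else 0) := by
        refine Finset.sum_congr rfl fun a _ => ?_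
        rw [Finset.mul_sum]
        refine Finset.sum_congr rfl fun b _ => ?_
        split_ifs <;> ring
    _ ≤ ∑ a, p a * 1 := Finset.sum_le_sum fun a _ =>
        mul_le_mul_of_nonneg_left (sum_class_div_classProb_le_one _ _) (hp0 a)
    _ = 1 := by simpa using hp1

/-- Submodularity of entropy: `M` is a function of `X` and `Y` together, and `Z` is a function
of each of them. -/
theorem setoidEnt_submodular (hp0 : ∀ ω, 0 ≤ p ω) (hp1 : ∑ ω, p ω = 1)
    {X Y Z M : Setoid Ω} (hM : X ⊓ Y ≤ M) (hX : X ≤ Z) (hY : Y ≤ Z) :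
    setoidEnt p M + setoidEnt p Z ≤ setoidEnt p X + setoidEnt p Y := by
  have hmono := setoidEnt_anti hp0 hM
  have hpt : ∀ ω, p ω - p ω * (classProb p X ω * classProb p Y ω /
      (classProb p (X ⊓ Y) ω * classProb p Z ω)) ≤
      p ω * Real.log (classProb p (X ⊓ Y) ω) + p ω * Real.log (classProb p Z ω)
      - p ω * Real.log (classProb p X ω) - p ω * Real.log (classProb p Y ω) := by
    intro ω
    rcases (hp0 ω).eq_or_lt with h0 | h0
    · simp [← h0]
    have hpos : ∀ r, 0 < classProb p r ω := fun r => h0.trans_le (le_classProb hp0 r ω)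
    have hlog := Real.log_le_sub_one_of_pos (div_pos (mul_pos (hpos X) (hpos Y))
      (mul_pos (hpos (X ⊓ Y)) (hpos Z)))
    rw [Real.log_div (mul_pos (hpos _) (hpos _)).ne' (mul_pos (hpos _) (hpos _)).ne',
      Real.log_mul (hpos _).ne' (hpos _).ne', Real.log_mul (hpos _).ne' (hpos _).ne'] at hlog
    have := mul_le_mul_of_nonneg_left hlog h0.le
    linarith
  have hsum := Finset.sum_le_sum fun ω (_ : ω ∈ Finset.univ) => hpt ω
  simp only [Finset.sum_sub_distrib, Finset.sum_add_distrib, hp1] at hsum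
  have := sum_classProb_ratio_le_one hp0 hp1 hX hY
  unfold setoidEnt at hmono ⊢
  linarith

/-- Independence passes to functions of independent variables. -/
theorem setoidEnt_indep_mono (hp0 : ∀ ω, 0 ≤ p ω) (hp1 : ∑ ω, p ω = 1)
    {X Y X' Y' : Setoid Ω} (h : setoidEnt p X + setoidEnt p Y ≤ setoidEnt p (X ⊓ Y))
    (hX : X ≤ X') (hY : Y ≤ Y') :
    setoidEnt p (X' ⊓ Y') = setoidEnt p X' + setoidEnt p Y' := by
  have h1 : setoidEnt p (X ⊓ Y) + setoidEnt p Y' ≤ setoidEnt p (X ⊓ Y') + setoidEnt p Y :=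
    setoidEnt_submodular hp0 hp1 (inf_le_inf_right _ inf_le_left) inf_le_right hY
  have h2 : setoidEnt p (X ⊓ Y') + setoidEnt p X' ≤ setoidEnt p X + setoidEnt p (X' ⊓ Y') :=
    setoidEnt_submodular hp0 hp1 (inf_le_inf_left _ inf_le_right) hX inf_le_left
  have h3 : setoidEnt p (X' ⊓ Y') + setoidEnt p ⊤ ≤ setoidEnt p X' + setoidEnt p Y' :=
    setoidEnt_submodular hp0 hp1 le_rfl le_top le_top
  rw [setoidEnt_top hp1] at h3
  linarith

/-- If `X` is determined by `Y`, then it is determined by everything that determines `Y`. -/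
theorem setoidEnt_inf_eq_of_le (hp0 : ∀ ω, 0 ≤ p ω) (hp1 : ∑ ω, p ω = 1)
    {X Y M : Setoid Ω} (h : setoidEnt p (X ⊓ Y) ≤ setoidEnt p Y) (hM : M ≤ Y) :
    setoidEnt p (X ⊓ M) = setoidEnt p M := by
  have h1 : setoidEnt p (X ⊓ M) + setoidEnt p Y ≤ setoidEnt p (X ⊓ Y) + setoidEnt p M :=
    setoidEnt_submodular hp0 hp1 (inf_le_inf_right _ inf_le_left) inf_le_right hM
  exact le_antisymm (by linarith) (setoidEnt_anti hp0 inf_le_right)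

theorem setoidEnt_inf_le (hp0 : ∀ ω, 0 ≤ p ω) (hp1 : ∑ ω, p ω = 1) (X Y : Setoid Ω) :
    setoidEnt p (X ⊓ Y) ≤ setoidEnt p X + setoidEnt p Y := by
  have h : setoidEnt p (X ⊓ Y) + setoidEnt p ⊤ ≤ setoidEnt p X + setoidEnt p Y :=
    setoidEnt_submodular hp0 hp1 le_rfl le_top le_top
  rwa [setoidEnt_top hp1, add_zero] at h

theorem setoidEnt_nonneg (hp0 : ∀ ω, 0 ≤ p ω) (hp1 : ∑ ω, p ω = 1) (X : Setoid Ω) :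
    0 ≤ setoidEnt p X :=
  (setoidEnt_top hp1).symm.trans_le (setoidEnt_anti hp0 le_top)

theorem prC_comp {α β : Type*} [Fintype α] [DecidableEq α] [DecidableEq β]
    (p : Ω → ℝ) (X : Ω → α) (f : α → β) (z : β) :
    prC p (fun ω => f (X ω)) z = ∑ x, if f x = z then prC p X x else 0 := by
  have := sum_prC_mul p X fun x => if f x = z then 1 else 0
  simp only [mul_ite, mul_one, mul_zero] at this
  exact this.symm

theorem setoidEnt_ker_comp_congr {α β : Type*} [Fintype α] [DecidableEq α] [Fintype β]
    {X Y : Ω → α} (h : ∀ z, prC p X z = prC p Y z) (f : α → β) :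
    setoidEnt p (Setoid.ker fun ω => f (X ω)) = setoidEnt p (Setoid.ker fun ω => f (Y ω)) := by
  classical
  rw [← entH_eq_setoidEnt, ← entH_eq_setoidEnt]
  simp only [entH, prC_comp, h]

theorem entH_pi_of_independent {𝕎 : Type*} [Fintype 𝕎] [DecidableEq 𝕎] {K : ℕ}
    (hp0 : ∀ ω, 0 ≤ p ω) (W : Fin K → Ω → 𝕎)
    (hind : ∀ w : Fin K → 𝕎, prC p (fun ω k => W k ω) w = ∏ k, prC p (W k) (w k)) :
    entH p (fun ω k => W k ω) = ∑ k, entH p (W k) := by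
  have hent : ∀ k, entH p (W k) = -∑ ω, p ω * Real.log (prC p (W k) (W k ω)) := fun k => by
    rw [entH, sum_prC_mul p (W k) fun x => Real.log (prC p (W k) x)]
  rw [entH, sum_prC_mul p _ fun x => Real.log (prC p (fun ω k => W k ω) x)]
  simp only [hent, hind]
  rw [Finset.sum_neg_distrib, Finset.sum_comm]
  congr 1
  refine Finset.sum_congr rfl fun ω _ => ?_
  rcases (hp0 ω).eq_or_lt with h0 | h0
  · simp [← h0]
  · rw [Real.log_prod, Finset.mul_sum]
    intro k _
    rw [prC_eq_classProb]
    exact (h0.trans_le (le_classProb hp0 _ _)).ne'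

theorem setoidEnt_kerOn_of_additive {ι α : Type*} [Fintype ι] [DecidableEq ι]
    (hp0 : ∀ ω, 0 ≤ p ω) (hp1 : ∑ ω, p ω = 1) (X : ι → Ω → α) (L : ℝ)
    (hX : ∀ i, setoidEnt p (Setoid.ker (X i)) = L)
    (htot : setoidEnt p (kerOn X univ) = Fintype.card ι * L) (B : Finset ι) :
    setoidEnt p (kerOn X B) = B.card * L := by
  have hle : ∀ B : Finset ι, setoidEnt p (kerOn X B) ≤ B.card * L := by
    intro B
    induction B using Finset.induction_on with
    | empty => simp [kerOn_empty, setoidEnt_top hp1]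
    | insert i B hi ih =>
      rw [kerOn_insert, Finset.card_insert_of_notMem hi]
      have := setoidEnt_inf_le hp0 hp1 (Setoid.ker (X i)) (kerOn X B)
      rw [hX] at this
      push_cast
      linarith
  have h1 := setoidEnt_inf_le hp0 hp1 (kerOn X B) (kerOn X Bᶜ)
  rw [← kerOn_union, Finset.union_compl, htot] at h1
  have h2 := hle Bᶜ
  have h3 : (B.card : ℝ) + Bᶜ.card = Fintype.card ι := by exact_mod_cast B.card_add_card_compl
  rw [← h3] at h1
  linarith [hle B]

end SetoidEntropy

/-- Converse bound on the common randomness of ETPIR when `E < T`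
(Section 6.2 of the paper):
`H(S) ≥ (E/(N-E)) · (L - ε) · (1 + (T-E)/(N-E) + ⋯ + ((T-E)/(N-E))^{K-1})`. -/
theorem stmt_5
    {Ω 𝕎 𝔹 𝔸 𝕊 : Type} [Fintype Ω] [Fintype 𝕎] [DecidableEq 𝕎]
    [Fintype 𝔹] [DecidableEq 𝔹] [Fintype 𝔸] [DecidableEq 𝔸]
    [Fintype 𝕊] [DecidableEq 𝕊]
    {K N E T : ℕ} (hE : 0 < E) (hET : E < T) (hTN : T ≤ N)
    (p : Ω → ℝ) (hp0 : ∀ ω, 0 ≤ p ω) (hp1 : ∑ ω, p ω = 1)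
    (W : Fin K → Ω → 𝕎) (Q : Fin N → Fin K → Ω → 𝔹)
    (A : Fin N → Fin K → Ω → 𝔸) (S : Ω → 𝕊)
    (L ε : ℝ)
    -- (i) the queries are independent of the messages
    (hQW : mutInfH p (fun ω (n : Fin N) (k : Fin K) => Q n k ω) (fun ω k => W k ω) = 0)
    -- (ii) the common randomness is independent of the messages and queries
    (hS : mutInfH p S
      (fun ω => ((fun k => W k ω), (fun (n : Fin N) (k : Fin K) => Q n k ω))) = 0)
    -- (iii) the answers are deterministic functions of query, messages and `S`
    (hA : ∀ (n : Fin N) (k : Fin K),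
      condEntH p (A n k) (fun ω => (Q n k ω, (fun j => W j ω), S ω)) = 0)
    -- the messages are mutually independent
    (hind : ∀ w : Fin K → 𝕎,
      prC p (fun ω k => W k ω) w = ∏ k, prC p (W k) (w k))
    -- each message has entropy `L`
    (hW : ∀ k : Fin K, entH p (W k) = L)
    -- E-security
    (hsec : ∀ ℰ : Finset (Fin N), ℰ.card = E → ∀ k : Fin K,
      mutInfH p (fun ω j => W j ω)
        (fun ω => ((fun (n : {x // x ∈ ℰ}) => A n.1 k ω),
                   (fun (n : {x // x ∈ ℰ}) => Q n.1 k ω))) = 0)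
    -- T-privacy
    (hpriv : ∀ 𝒯 : Finset (Fin N), 𝒯.card = T → ∀ k k' : Fin K,
      ∀ z, prC p (fun ω => ((fun (n : {x // x ∈ 𝒯}) => A n.1 k ω),
                            (fun (n : {x // x ∈ 𝒯}) => Q n.1 k ω),
                            (fun j => W j ω), S ω)) z
         = prC p (fun ω => ((fun (n : {x // x ∈ 𝒯}) => A n.1 k' ω),
                            (fun (n : {x // x ∈ 𝒯}) => Q n.1 k' ω),
                            (fun j => W j ω), S ω)) z)
    -- ε-correctness for every message
    (hcor : ∀ k : Fin K, condEntH p (W k)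
      (fun ω => ((fun (n : Fin N) => A n k ω),
                 (fun (n : Fin N) => Q n k ω))) ≤ ε) :
    entH p S ≥ ((E : ℝ) / ((N : ℝ) - E)) * (L - ε) *
      ∑ i ∈ Finset.range K, (((T : ℝ) - E) / ((N : ℝ) - E)) ^ i := by
  rcases Nat.eq_zero_or_pos K with rfl | hK
  · simpa [entH_eq_setoidEnt] using setoidEnt_nonneg hp0 hp1 (Setoid.ker S)
  have anti : ∀ {r s : Setoid Ω}, r ≤ s → setoidEnt p s ≤ setoidEnt p r := setoidEnt_anti hp0
  have submod : ∀ {X Y Z M : Setoid Ω}, X ⊓ Y ≤ M → X ≤ Z → Y ≤ Z →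
      setoidEnt p M + setoidEnt p Z ≤ setoidEnt p X + setoidEnt p Y :=
    setoidEnt_submodular hp0 hp1
  simp only [mutInfH, condEntH, entH_eq_setoidEnt, ker_prodMk] at hQW hS hA hW hsec hcor
  rw [entH_eq_setoidEnt]
  let a : Fin K → Finset (Fin N) → Setoid Ω := fun k => kerOn fun n => A n k
  let q : Fin K → Finset (Fin N) → Setoid Ω := fun k => kerOn fun n => Q n k
  let w : Finset (Fin K) → Setoid Ω := kerOn W
  let s : Setoid Ω := Setoid.ker S
  let qs : Setoid Ω := Setoid.ker fun ω (n : Fin N) (k : Fin K) => Q n k ω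
  have hqs : ∀ k B, qs ≤ q k B := fun k B _ _ h =>
    kerOn_iff.2 fun n _ => congrFun (congrFun h n) k
  have hw_ent : ∀ C, setoidEnt p (w C) = C.card * L := by
    refine setoidEnt_kerOn_of_additive hp0 hp1 W L hW ?_
    rw [kerOn_univ, ← entH_eq_setoidEnt, entH_pi_of_independent hp0 W hind]
    simp [entH_eq_setoidEnt, hW]
  rw [← kerOn_univ W] at hQW hS
  simp only [← kerOn_univ W] at hA hsec
  simp only [← kerOn_univ] at hcor
  -- the messages and the common randomness are jointly independent of the queries
  have hindep : ∀ k B, setoidEnt p ((w univ ⊓ s) ⊓ q k B) =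
      setoidEnt p (w univ ⊓ s) + setoidEnt p (q k B) := by
    intro k B
    refine setoidEnt_indep_mono hp0 hp1 (Y := qs) ?_ le_rfl (hqs k B)
    have h1 := setoidEnt_inf_le hp0 hp1 (w univ) s
    have h2 : setoidEnt p (s ⊓ (w univ ⊓ qs)) = setoidEnt p ((w univ ⊓ s) ⊓ qs) := by
      rw [inf_left_comm, inf_assoc]
    have h3 : setoidEnt p (qs ⊓ w univ) = setoidEnt p (w univ ⊓ qs) := by rw [inf_comm]
    linarith
  have hdet : ∀ k B M, M ≤ (w univ ⊓ s) ⊓ q k B →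
      setoidEnt p (a k B ⊓ M) = setoidEnt p M := by
    intro k B
    induction B using Finset.induction_on with
    | empty => intro M _; simp [a, kerOn_empty]
    | insert n B _ ih =>
      intro M hM
      have hM' : M ≤ (w univ ⊓ s) ⊓ q k B :=
        hM.trans (inf_le_inf_left _ (kerOn_anti _ (Finset.subset_insert _ _)))
      have h1 : a k (insert n B) ⊓ M = Setoid.ker (A n k) ⊓ (a k B ⊓ M) := by
        simp only [a, kerOn_insert, inf_assoc]
      rw [h1, ← ih M hM']
      refine setoidEnt_inf_eq_of_le hp0 hp1 (sub_eq_zero.1 (hA n k)).le ?_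
      exact fun _ _ h => ⟨kerOn_iff.1 (hM h.2).2 n (Finset.mem_insert_self _ _), (hM h.2).1⟩
  have hlocal : ∀ k B C, setoidEnt p (a k B ⊓ w C ⊓ q k univ) - setoidEnt p (q k univ) =
      setoidEnt p (a k B ⊓ w C ⊓ q k B) - setoidEnt p (q k B) := by
    intro k B C
    have hq : q k univ ≤ q k B := kerOn_anti _ (subset_univ _)
    have hw : w univ ≤ w C := kerOn_anti _ (subset_univ _)
    have h1 : setoidEnt p (a k B ⊓ w C ⊓ q k univ) + setoidEnt p (q k B) ≤
        setoidEnt p (a k B ⊓ w C ⊓ q k B) + setoidEnt p (q k univ) :=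
      submod (inf_le_inf_right _ inf_le_left) inf_le_right hq
    have h2 : setoidEnt p (a k B ⊓ ((w univ ⊓ s) ⊓ q k univ)) +
        setoidEnt p (a k B ⊓ w C ⊓ q k B) ≤ setoidEnt p (a k B ⊓ w C ⊓ q k univ) +
        setoidEnt p (a k B ⊓ ((w univ ⊓ s) ⊓ q k B)) :=
      submod (fun _ _ h => ⟨h.1.1.1, h.2.2.1, h.1.2⟩) (inf_le_inf_left _ hq)
        (fun _ _ h => ⟨⟨h.1, hw h.2.1.1⟩, h.2.2⟩)
    rw [hdet k B _ (inf_le_inf_left _ hq), hdet k B _ le_rfl, hindep, hindep] at h2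
    linarith
  have hsecure : ∀ k B C, B.card = E →
      setoidEnt p (a k B ⊓ w C ⊓ q k univ) - setoidEnt p (q k univ) =
      setoidEnt p (a k B ⊓ w ∅ ⊓ q k univ) - setoidEnt p (q k univ) + C.card * L := by
    intro k B C hB
    have h1 : setoidEnt p (w C ⊓ (a k B ⊓ q k B)) =
        setoidEnt p (w C) + setoidEnt p (a k B ⊓ q k B) :=
      setoidEnt_indep_mono hp0 hp1 (sub_nonpos.1 (hsec B hB k).le)
        (kerOn_anti W (subset_univ C)) le_rfl
    have h2 : a k B ⊓ w C ⊓ q k B = w C ⊓ (a k B ⊓ q k B) := by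
      rw [inf_comm (a k B), inf_assoc]
    have h3 : a k B ⊓ w ∅ ⊓ q k B = a k B ⊓ q k B := by simp [w, kerOn_empty]
    rw [hlocal, hlocal, h2, h3, h1, hw_ent]
    ring
  refine randomness_bound_of_submodular hE hET hTN hK L ε _
    (fun k B C => setoidEnt p (a k B ⊓ w C ⊓ q k univ) - setoidEnt p (q k univ))
    ?_ ?_ ?_ ?_ hsecure ?_ ?_
  · intro k C X Y Z hX hY
    have := submod (X := a k X ⊓ w C ⊓ q k univ) (Y := a k Y ⊓ w C ⊓ q k univ)
      (Z := a k Z ⊓ w C ⊓ q k univ) (M := a k (X ∪ Y) ⊓ w C ⊓ q k univ)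
      (by
        simp only [a, kerOn_union]
        exact fun _ _ h => ⟨⟨⟨h.1.1.1, h.2.1.1⟩, h.1.1.2⟩, h.1.2⟩)
      (inf_le_inf_right _ (inf_le_inf_right _ (kerOn_anti _ hX)))
      (inf_le_inf_right _ (inf_le_inf_right _ (kerOn_anti _ hY)))
    linarith
  · intro k C X Y hXY
    exact sub_le_sub_right
      (anti (inf_le_inf_right _ (inf_le_inf_right _ (kerOn_anti _ hXY)))) _
  · intro k
    simp [a, w, kerOn_empty]
  · intro k k' B C hB
    obtain ⟨𝒯, hB𝒯, h𝒯⟩ := Finset.exists_superset_card_eq hB (by simpa using hTN)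
    have h1 := setoidEnt_ker_comp_congr (hpriv 𝒯 h𝒯 k k') fun z =>
      (((fun i : {x // x ∈ B} => z.1 ⟨i.1, hB𝒯 i.2⟩), fun j : {x // x ∈ C} => z.2.2.1 j.1),
        fun i : {x // x ∈ B} => z.2.1 ⟨i.1, hB𝒯 i.2⟩)
    have h2 := setoidEnt_ker_comp_congr (hpriv 𝒯 h𝒯 k k') fun z =>
      fun i : {x // x ∈ B} => z.2.1 ⟨i.1, hB𝒯 i.2⟩
    simp only [ker_prodMk] at h1
    rw [hlocal, hlocal]
    exact congrArg₂ (· - ·) h1 h2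
  · intro k C
    have h1 := hcor k
    have h2 := submod (X := a k univ ⊓ w C ⊓ q k univ)
      (Y := Setoid.ker (W k) ⊓ (a k univ ⊓ q k univ))
      (Z := a k univ ⊓ q k univ) (M := a k univ ⊓ w (insert k C) ⊓ q k univ)
      (by
        simp only [w, kerOn_insert]
        exact fun _ _ h => ⟨⟨h.1.1.1, h.2.1, h.1.1.2⟩, h.1.2⟩)
      (fun _ _ h => ⟨h.1.1, h.2⟩) inf_le_right
    linarith
  · intro k B hB
    have h1 := hsecure k B univ hB
    have h2 : setoidEnt p (a k B ⊓ w univ ⊓ q k univ) ≤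
        setoidEnt p (a k B ⊓ ((w univ ⊓ s) ⊓ q k univ)) :=
      anti fun _ _ h => ⟨⟨h.1, h.2.1.1⟩, h.2.2⟩
    rw [hdet k B _ (inf_le_inf_left _ (kerOn_anti _ (subset_univ _))), hindep] at h2
    have h3 := setoidEnt_inf_le hp0 hp1 (w univ) s
    rw [hw_ent] at h3
    linarith
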